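/- Let m ≥ 2, α⃗ ∈ U_m, 1 ≤ i ≤ m, and 1 < p₁,…,p_m, r < ∞ with Σ_{j=1}^m 1/p_j = 1/r, and let b be locally integrable. If there is a constant C such that ‖[b, P^{α⃗}]_i(f₁,…,f_m)‖_{L^r} ≤ C ∏_{j=1}^m ‖f_j‖_{L^{p_j}} for all bounded compactly supported f₁,…,f_m, then b ∈ BMO^d, and ‖b‖_{BMO^d} ≤ C'·C for a constant C' depending only on m, α⃗, p₁,…,p_m, r. -/

import Mathlib

open MeasureTheory Filter Topology
open scoped ENNReal NNReal Classical

noncomputable section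

/-- The dyadic interval `[n·2⁻ᵏ, (n+1)·2⁻ᵏ)`. -/
def dyadicI (n k : ℤ) : Set ℝ :=
  Set.Ico ((n : ℝ) * (2 : ℝ) ^ (-k)) (((n : ℝ) + 1) * (2 : ℝ) ^ (-k))

/-- The Haar function `h_I = |I|^{-1/2} (1_{I₊} - 1_{I₋})` of the dyadic interval
`I = [n·2⁻ᵏ, (n+1)·2⁻ᵏ)`, whose halves are the dyadic intervals indexed by
`(2n, k+1)` and `(2n+1, k+1)`. -/
def haarF (n k : ℤ) : ℝ → ℝ := fun x =>
  (Real.sqrt ((2 : ℝ) ^ (-k)))⁻¹ *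
    ((dyadicI (2 * n + 1) (k + 1)).indicator (fun _ => (1 : ℝ)) x -
      (dyadicI (2 * n) (k + 1)).indicator (fun _ => (1 : ℝ)) x)

/-- `⟨f, h_I⟩ = ∫ f h_I`. -/
def pairH (f : ℝ → ℝ) (n k : ℤ) : ℝ := ∫ x, f x * haarF n k x

/-- `⟨f⟩_I = |I|⁻¹ ∫_I f`. -/
def avgI (f : ℝ → ℝ) (n k : ℤ) : ℝ := (2 : ℝ) ^ k * ∫ x in dyadicI n k, f x

/-- `f(I, α)` for `α ∈ {0,1}`, where `false` is `0` (Haar coefficient)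
and `true` is `1` (average). -/
def coefI (f : ℝ → ℝ) (a : Bool) (n k : ℤ) : ℝ := if a then avgI f n k else pairH f n k

/-- `σ(α⃗)`, the number of `0` components of `α⃗ ∈ {0,1}^m`. -/
def sigmaV {m : ℕ} (α : Fin m → Bool) : ℕ := (Finset.univ.filter fun j => α j = false).card

/-- The term `P_I^{α⃗}(f₁,…,f_m)(x) = (∏ f_j(I,α_j)) h_I^{σ(α⃗)}(x)` for `I = (n,k)`. -/
def Pterm {m : ℕ} (α : Fin m → Bool) (f : Fin m → ℝ → ℝ) (n k : ℤ) (x : ℝ) : ℝ :=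
  (∏ j, coefI (f j) (α j) n k) * haarF n k x ^ sigmaV α

/-- The term of the paraproduct `π_b^{α⃗}`:
`⟨b, h_I⟩ (∏ f_j(I,α_j)) h_I^{1+σ(α⃗)}(x)` for `I = (n,k)`. -/
def piTerm {m : ℕ} (b : ℝ → ℝ) (α : Fin m → Bool) (f : Fin m → ℝ → ℝ) (n k : ℤ) (x : ℝ) : ℝ :=
  pairH b n k * (∏ j, coefI (f j) (α j) n k) * haarF n k x ^ (1 + sigmaV α)

/-- The term of the `m`-linear Haar multiplier `T_ε^{α⃗}`:
`ε_I (∏ f_j(I,α_j)) h_I^{σ(α⃗)}(x)` for `I = (n,k)`. -/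
def Tterm {m : ℕ} (ε : ℤ → ℤ → ℝ) (α : Fin m → Bool) (f : Fin m → ℝ → ℝ) (n k : ℤ) (x : ℝ) : ℝ :=
  ε n k * (∏ j, coefI (f j) (α j) n k) * haarF n k x ^ sigmaV α

/-- Partial sum of a series indexed by the dyadic grid: all scales `k` with `|k| ≤ N`
(at each scale the sum over positions is a `tsum`). -/
def dyadicPartialSum (F : ℤ → ℤ → ℝ → ℝ) (N : ℕ) (x : ℝ) : ℝ :=
  ∑ k ∈ Finset.Icc (-(N : ℤ)) (N : ℤ), ∑' n : ℤ, F n k x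

/-- `g` is the a.e.-pointwise sum of the series `Σ_{I ∈ 𝒟} F_I`. -/
def HasDyadicSum (F : ℤ → ℤ → ℝ → ℝ) (g : ℝ → ℝ) : Prop :=
  ∀ᵐ x : ℝ ∂volume, Tendsto (fun N => dyadicPartialSum F N x) atTop (𝓝 (g x))

/-- The dyadic BMO norm `sup_{I∈𝒟} |I|⁻¹ ∫_I |b - ⟨b⟩_I|`. -/
def bmoNorm (b : ℝ → ℝ) : ℝ≥0∞ :=
  ⨆ (n : ℤ) (k : ℤ),
    ENNReal.ofReal ((2 : ℝ) ^ k) * ∫⁻ x in dyadicI n k, ENNReal.ofReal |b x - avgI b n k|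

/-- The weak `L^r` quasinorm `sup_{t>0} t |{|f| > t}|^{1/r}`. -/
def wnorm' (r : ℝ) (f : ℝ → ℝ) : ℝ≥0∞ :=
  ⨆ t : ℝ≥0, (t : ℝ≥0∞) * volume {x : ℝ | (t : ℝ) < |f x|} ^ (1 / r)

/-- `sup_{I∈𝒟} |⟨b,h_I⟩| / √|I|`. -/
def starNorm (b : ℝ → ℝ) : ℝ≥0∞ :=
  ⨆ (n : ℤ) (k : ℤ), ENNReal.ofReal (|pairH b n k| / Real.sqrt ((2 : ℝ) ^ (-k)))

/-- Bounded, compactly supported, measurable function. -/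
def BCS (f : ℝ → ℝ) : Prop :=
  Measurable f ∧ (∃ M : ℝ, ∀ x, |f x| ≤ M) ∧ HasCompactSupport f

/-- `‖ε‖_∞ = sup_{I∈𝒟} |ε_I|` for a symbol sequence indexed by the dyadic grid. -/
def epsNorm (ε : ℤ → ℤ → ℝ) : ℝ≥0∞ := ⨆ (n : ℤ) (k : ℤ), ENNReal.ofReal |ε n k|

lemma mem_dyadicI {n k : ℤ} {x : ℝ} : x ∈ dyadicI n k ↔ ⌊x * (2 : ℝ) ^ k⌋ = n := by
  have h : (0 : ℝ) < 2 ^ k := by positivity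
  rw [dyadicI, Set.mem_Ico, Int.floor_eq_iff, zpow_neg, ← div_eq_mul_inv, ← div_eq_mul_inv,
    div_le_iff₀ h, lt_div_iff₀ h]

lemma measurableSet_dyadicI (n k : ℤ) : MeasurableSet (dyadicI n k) := measurableSet_Ico

lemma volume_dyadicI (n k : ℤ) : volume (dyadicI n k) = ENNReal.ofReal ((2 : ℝ) ^ (-k)) := by
  rw [dyadicI, Real.volume_Ico]
  congr 1
  ring

lemma volume_real_dyadicI (n k : ℤ) : volume.real (dyadicI n k) = (2 : ℝ) ^ (-k) := by
  rw [measureReal_def, volume_dyadicI, ENNReal.toReal_ofReal (by positivity)]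

lemma floor_mul_two_zpow_coarse (x : ℝ) (k : ℤ) (d : ℕ) :
    ⌊x * (2 : ℝ) ^ k⌋ = ⌊x * (2 : ℝ) ^ (k + d)⌋ / 2 ^ d := by
  have h := Int.floor_div_natCast (x * (2 : ℝ) ^ (k + d)) (2 ^ d)
  rw [zpow_add₀ two_ne_zero, zpow_natCast, ← mul_assoc] at h
  push_cast at h
  rw [mul_div_assoc, div_self (by positivity), mul_one] at h
  rw [h, zpow_add₀ two_ne_zero, zpow_natCast, ← mul_assoc]

/-- Points of one dyadic interval lie in the same dyadic interval of every coarser scale. -/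
lemma mem_dyadicI_congr {n k a q : ℤ} (hkq : k ≤ q) {x y : ℝ} (hx : x ∈ dyadicI a q)
    (hy : y ∈ dyadicI a q) : x ∈ dyadicI n k ↔ y ∈ dyadicI n k := by
  obtain ⟨d, rfl⟩ := Int.le.dest hkq
  rw [mem_dyadicI] at *
  rw [mem_dyadicI, floor_mul_two_zpow_coarse x k d, floor_mul_two_zpow_coarse y k d, hx, hy]

lemma dyadicI_subset_coarse (n k : ℤ) (d : ℕ) :
    dyadicI n (k + d) ⊆ dyadicI (n / 2 ^ d) k := by
  intro x hx
  rw [mem_dyadicI] at *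
  rw [floor_mul_two_zpow_coarse x k d, hx]

lemma eq_of_mem_dyadicI {n n' k : ℤ} {x : ℝ} (h : x ∈ dyadicI n k) (h' : x ∈ dyadicI n' k) :
    n = n' := by
  rw [mem_dyadicI] at *
  omega

lemma dyadicI_nonempty (n k : ℤ) : (dyadicI n k).Nonempty := by
  refine ⟨n * 2 ^ (-k), le_rfl, ?_⟩
  have : (0 : ℝ) < 2 ^ (-k) := by positivity
  linarith

lemma haarF_congr {n k a q : ℤ} (hkq : k < q) {x y : ℝ} (hx : x ∈ dyadicI a q)
    (hy : y ∈ dyadicI a q) : haarF n k x = haarF n k y := by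
  have h (c : ℤ) := mem_dyadicI_congr (n := c) (show k + 1 ≤ q by omega) hx hy
  simp only [haarF, Set.indicator, h]

lemma mem_dyadicI_iff_half (n k : ℤ) (x : ℝ) :
    x ∈ dyadicI n k ↔ x ∈ dyadicI (2 * n) (k + 1) ∨ x ∈ dyadicI (2 * n + 1) (k + 1) := by
  have := floor_mul_two_zpow_coarse x k 1
  simp only [mem_dyadicI]
  push_cast at this
  omega

lemma haarF_eq_zero {n k : ℤ} {x : ℝ} (hx : x ∉ dyadicI n k) : haarF n k x = 0 := by
  rw [mem_dyadicI_iff_half] at hx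
  push Not at hx
  simp [haarF, hx.1, hx.2]

lemma abs_haarF {n k : ℤ} {x : ℝ} (hx : x ∈ dyadicI n k) :
    |haarF n k x| = (Real.sqrt ((2 : ℝ) ^ (-k)))⁻¹ := by
  rw [mem_dyadicI_iff_half] at hx
  have h0 : 0 ≤ (Real.sqrt ((2 : ℝ) ^ (-k)))⁻¹ := by positivity
  rcases hx with hx | hx
  · have : x ∉ dyadicI (2 * n + 1) (k + 1) := fun h => by
      have := eq_of_mem_dyadicI hx h
      omega
    simp only [haarF, Set.indicator_of_mem hx, Set.indicator_of_notMem this]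
    rw [abs_mul, abs_of_nonneg h0]
    norm_num
  · have : x ∉ dyadicI (2 * n) (k + 1) := fun h => by
      have := eq_of_mem_dyadicI hx h
      omega
    simp only [haarF, Set.indicator_of_mem hx, Set.indicator_of_notMem this]
    rw [abs_mul, abs_of_nonneg h0]
    norm_num

lemma measurable_haarF (n k : ℤ) : Measurable (haarF n k) :=
  ((measurable_const.indicator (measurableSet_dyadicI _ _)).sub
    (measurable_const.indicator (measurableSet_dyadicI _ _))).const_mul _

lemma integrable_indicator_dyadicI (n k : ℤ) :
    Integrable ((dyadicI n k).indicator fun _ => (1 : ℝ)) := by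
  rw [integrable_indicator_iff (measurableSet_dyadicI n k)]
  exact integrableOn_const (by simp [volume_dyadicI])

lemma integral_haarF (n k : ℤ) : ∫ x, haarF n k x = 0 := by
  simp only [haarF]
  rw [integral_const_mul, integral_sub (integrable_indicator_dyadicI _ _)
    (integrable_indicator_dyadicI _ _), integral_indicator_const _ (measurableSet_dyadicI _ _),
    integral_indicator_const _ (measurableSet_dyadicI _ _)]
  simp [volume_real_dyadicI]

lemma pairH_eq_zero_of_disjoint {f : ℝ → ℝ} {n k : ℤ} (h : ∀ x ∈ dyadicI n k, f x = 0) :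
    pairH f n k = 0 := by
  rw [pairH, ← integral_zero ℝ ℝ (μ := volume)]
  congr 1
  ext x
  by_cases hx : x ∈ dyadicI n k
  · simp [h x hx]
  · simp [haarF_eq_zero hx]

lemma avgI_eq_zero_of_disjoint {f : ℝ → ℝ} {n k : ℤ} (h : ∀ x ∈ dyadicI n k, f x = 0) :
    avgI f n k = 0 := by
  rw [avgI, setIntegral_eq_zero_of_forall_eq_zero h, mul_zero]

lemma integral_haarF_mul_haarF_of_lt {n k a q : ℤ} (hkq : k < q) :
    ∫ x, haarF n k x * haarF a q x = 0 := by
  obtain ⟨y, hy⟩ := dyadicI_nonempty a q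
  have : ∀ x, haarF n k x * haarF a q x = haarF n k y * haarF a q x := by
    intro x
    by_cases hx : x ∈ dyadicI a q
    · rw [haarF_congr hkq hx hy]
    · simp [haarF_eq_zero hx]
  simp_rw [this]
  rw [integral_const_mul, integral_haarF, mul_zero]

lemma pairH_haarF_of_ne {n k a q : ℤ} (h : (a, q) ≠ (n, k)) : pairH (haarF n k) a q = 0 := by
  rcases lt_trichotomy k q with hkq | rfl | hkq
  · exact integral_haarF_mul_haarF_of_lt hkq
  · refine pairH_eq_zero_of_disjoint fun x hx => haarF_eq_zero fun hx' => h ?_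
    rw [eq_of_mem_dyadicI hx hx']
  · simp_rw [pairH, mul_comm (haarF n k _)]
    exact integral_haarF_mul_haarF_of_lt hkq

lemma pairH_haarF_self (n k : ℤ) : pairH (haarF n k) n k = 1 := by
  have : ∀ x, haarF n k x * haarF n k x =
      (dyadicI n k).indicator (fun _ => ((2 : ℝ) ^ (-k))⁻¹) x := by
    intro x
    by_cases hx : x ∈ dyadicI n k
    · rw [← abs_mul_abs_self, abs_haarF hx, Set.indicator_of_mem hx, ← mul_inv,
        Real.mul_self_sqrt (by positivity)]
    · simp [haarF_eq_zero hx, hx]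
  simp_rw [pairH, this]
  rw [integral_indicator_const _ (measurableSet_dyadicI _ _), volume_real_dyadicI, smul_eq_mul,
    mul_inv_cancel₀ (by positivity)]

lemma avgI_indicator_self (n k : ℤ) : avgI ((dyadicI n k).indicator fun _ => 1) n k = 1 := by
  rw [avgI, setIntegral_indicator (measurableSet_dyadicI _ _), Set.inter_self, setIntegral_const,
    volume_real_dyadicI, zpow_neg, smul_eq_mul, mul_one, mul_inv_cancel₀ (by positivity)]

lemma setIntegral_indicator_of_subset {n k a q : ℤ} (h : dyadicI n k ⊆ dyadicI a q) :
    ∫ x in dyadicI a q, (dyadicI n k).indicator (fun _ => (1 : ℝ)) x = 2 ^ (-k) := by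
  rw [setIntegral_indicator (measurableSet_dyadicI _ _), Set.inter_eq_self_of_subset_right h,
    setIntegral_const, volume_real_dyadicI, smul_eq_mul, mul_one]

lemma setIntegral_indicator_of_disjoint {n k a q : ℤ} (h : Disjoint (dyadicI n k) (dyadicI a q)) :
    ∫ x in dyadicI a q, (dyadicI n k).indicator (fun _ => (1 : ℝ)) x = 0 :=
  setIntegral_eq_zero_of_forall_eq_zero fun _ hx =>
    Set.indicator_of_notMem (h.notMem_of_mem_right hx) _

/-- If only the interval `(n₀, k₀)` contributes, the dyadic series is a single term. -/
lemma hasDyadicSum_single {F : ℤ → ℤ → ℝ → ℝ} {n₀ k₀ : ℤ}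
    (h : ∀ n k x, (n, k) ≠ (n₀, k₀) → F n k x = 0) : HasDyadicSum F (F n₀ k₀) := by
  refine Eventually.of_forall fun x => tendsto_const_nhds.congr' ?_
  filter_upwards [eventually_ge_atTop k₀.natAbs] with N hN
  rw [dyadicPartialSum, Finset.sum_eq_single k₀, tsum_eq_single n₀]
  · intro n hn
    exact h _ _ _ (by simp [hn])
  · intro k _ hk
    simp [h _ k x (by simp [hk] : (_, k) ≠ (n₀, k₀))]
  · intro hk
    rw [Finset.mem_Icc] at hk
    omega

lemma lintegral_abs_sub_avgI_le {b : ℝ → ℝ} (hb : LocallyIntegrable b volume) (n k : ℤ) (d : ℝ) :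
    ∫⁻ x in dyadicI n k, ENNReal.ofReal |b x - avgI b n k| ≤
      2 * ∫⁻ x in dyadicI n k, ENNReal.ofReal |b x - d| := by
  have hI : IntegrableOn b (dyadicI n k) :=
    (hb.integrableOn_isCompact isCompact_Icc).mono_set Set.Ico_subset_Icc_self
  have hfin : IntegrableOn (fun _ : ℝ => d) (dyadicI n k) :=
    integrableOn_const (by simp [volume_dyadicI])
  have hint : IntegrableOn (fun x => b x - d) (dyadicI n k) := hI.sub hfin
  have havg : ENNReal.ofReal |d - avgI b n k| * volume (dyadicI n k) ≤
      ∫⁻ x in dyadicI n k, ENNReal.ofReal |b x - d| := by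
    rw [← ofReal_integral_eq_lintegral_ofReal hint.abs (ae_of_all _ fun x => abs_nonneg _),
      volume_dyadicI, ← ENNReal.ofReal_mul (abs_nonneg _)]
    refine ENNReal.ofReal_le_ofReal (le_trans (le_of_eq ?_) abs_integral_le_integral_abs)
    rw [integral_sub hI hfin, setIntegral_const, volume_real_dyadicI, avgI, smul_eq_mul]
    have h2 : (0 : ℝ) < 2 ^ (-k) := by positivity
    rw [← abs_of_pos h2, ← abs_mul, abs_of_pos h2, abs_sub_comm, sub_mul, mul_right_comm,
      ← zpow_add₀ two_ne_zero]
    simp [mul_comm]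
  calc _ ≤ ∫⁻ x in dyadicI n k, (ENNReal.ofReal |b x - d| + ENNReal.ofReal |d - avgI b n k|) :=
        lintegral_mono fun x => by
          rw [← ENNReal.ofReal_add (abs_nonneg _) (abs_nonneg _)]
          exact ENNReal.ofReal_le_ofReal (abs_sub_le _ _ _)
    _ ≤ _ := by
        rw [lintegral_add_right _ measurable_const, setLIntegral_const, two_mul]
        gcongr

lemma BCS.of_abs_le_indicator {f : ℝ → ℝ} (hf : Measurable f) {a a' k : ℤ}
    (h : ∀ x, |f x| ≤ (dyadicI a k ∪ dyadicI a' k).indicator 1 x) : BCS f := by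
  refine ⟨hf, ⟨1, fun x => (h x).trans (Set.indicator_le_self' (by simp) x)⟩, ?_⟩
  have hS : Bornology.IsBounded (dyadicI a k ∪ dyadicI a' k) :=
    (Metric.isBounded_Ico _ _).union (Metric.isBounded_Ico _ _)
  refine HasCompactSupport.intro hS.isCompact_closure fun x hx => abs_nonpos_iff.1 ((h x).trans ?_)
  rw [Set.indicator_of_notMem fun hx' => hx (subset_closure hx')]

lemma eLpNorm_le_of_abs_le_indicator {f : ℝ → ℝ} {a a' k : ℤ} {p : ℝ} (hp : 1 < p)
    (h : ∀ x, |f x| ≤ (dyadicI a k ∪ dyadicI a' k).indicator 1 x) :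
    eLpNorm f (ENNReal.ofReal p) volume ≤ ENNReal.ofReal ((2 * 2 ^ (-k)) ^ (1 / p)) := by
  have hS : volume (dyadicI a k ∪ dyadicI a' k) ≤ ENNReal.ofReal (2 * 2 ^ (-k)) := by
    refine (measure_union_le _ _).trans_eq ?_
    rw [volume_dyadicI, volume_dyadicI, ← ENNReal.ofReal_add (by positivity) (by positivity),
      two_mul]
  refine (eLpNorm_mono_real h).trans ((eLpNorm_indicator_const_le (1 : ℝ) _).trans ?_)
  rw [enorm_one, one_mul, ENNReal.toReal_ofReal (by linarith),
    ← ENNReal.ofReal_rpow_of_pos (by positivity)]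
  exact ENNReal.rpow_le_rpow hS (by positivity)

/-- Testing the commutator on functions `f` for which only the interval `(n₀, k₀)` contributes to
the paraproducts bounds the mean oscillation of `b` on subintervals of `(n₀, k₀)`. -/
lemma oscillation_le_of_commutator_bound {m : ℕ} {α : Fin m → Bool} {i : Fin m} {p : Fin m → ℝ}
    (hp : ∀ j, 1 < p j) {r : ℝ} (hr1 : 1 < r) (hr : ∑ j, 1 / p j = 1 / r) {b : ℝ → ℝ}
    (hb : LocallyIntegrable b volume) {C : ℝ}
    (hC : ∀ (f : Fin m → ℝ → ℝ) (g₁ g₂ : ℝ → ℝ), (∀ j, BCS (f j)) →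
      HasDyadicSum (Pterm α f) g₁ →
      HasDyadicSum (Pterm α (Function.update f i fun x => b x * f i x)) g₂ →
      eLpNorm' (fun x => b x * g₁ x - g₂ x) r volume ≤
        ENNReal.ofReal C * ∏ j, eLpNorm (f j) (ENNReal.ofReal (p j)) volume)
    {n k n₀ k₀ : ℤ} (hsub : dyadicI n k ⊆ dyadicI n₀ k₀) {f : Fin m → ℝ → ℝ}
    (hfm : ∀ j, Measurable (f j))
    (hf : ∀ j, ∃ a a', ∀ x, |f j x| ≤ (dyadicI a k ∪ dyadicI a' k).indicator 1 x)
    (h₁ : ∀ a q, (a, q) ≠ (n₀, k₀) → ∏ j, coefI (f j) (α j) a q = 0)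
    (h₂ : ∀ a q, (a, q) ≠ (n₀, k₀) →
      ∏ j, coefI (Function.update f i (fun x => b x * f i x) j) (α j) a q = 0)
    {c : ℝ} (hc : 0 < c)
    (hcA : c ≤ |∏ j, coefI (f j) (α j) n₀ k₀| * (Real.sqrt (2 ^ (-k₀)))⁻¹ ^ sigmaV α) :
    ENNReal.ofReal (2 ^ k) * ∫⁻ x in dyadicI n k, ENNReal.ofReal |b x - avgI b n k| ≤
      ENNReal.ofReal (4 * c⁻¹ * C) := by
  set A := ∏ j, coefI (f j) (α j) n₀ k₀
  set B := ∏ j, coefI (Function.update f i (fun x => b x * f i x) j) (α j) n₀ k₀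
  set G : ℝ → ℝ := fun x => b x * (A * haarF n₀ k₀ x ^ sigmaV α) - B * haarF n₀ k₀ x ^ sigmaV α
    with hG
  have hA0 : A ≠ 0 := by
    intro h
    rw [h, abs_zero, zero_mul] at hcA
    linarith
  have hbound : eLpNorm' G r volume ≤
      ENNReal.ofReal C * ∏ j, eLpNorm (f j) (ENNReal.ofReal (p j)) volume := by
    refine hC f (Pterm α f n₀ k₀) (Pterm α (Function.update f i fun x => b x * f i x) n₀ k₀)
      (fun j => ?_) (hasDyadicSum_single fun a q x h => ?_) (hasDyadicSum_single fun a q x h => ?_)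
    · obtain ⟨a, a', h⟩ := hf j
      exact BCS.of_abs_le_indicator (hfm j) h
    · rw [Pterm, h₁ a q h, zero_mul]
    · rw [Pterm, h₂ a q h, zero_mul]
  have hprod : ∏ j, eLpNorm (f j) (ENNReal.ofReal (p j)) volume ≤
      ENNReal.ofReal ((2 * 2 ^ (-k)) ^ (1 / r)) := by
    rw [← hr, Real.rpow_sum_of_pos (by positivity),
      ENNReal.ofReal_prod_of_nonneg fun j _ => by positivity]
    refine Finset.prod_le_prod' fun j _ => ?_
    obtain ⟨a, a', h⟩ := hf j
    exact eLpNorm_le_of_abs_le_indicator (hp j) h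
  have hGm : AEStronglyMeasurable G volume :=
    (hb.aestronglyMeasurable.mul
      (((measurable_haarF n₀ k₀).pow_const _).const_mul A).aestronglyMeasurable).sub
      (((measurable_haarF n₀ k₀).pow_const _).const_mul B).aestronglyMeasurable
  have hpt : ∀ x ∈ dyadicI n k, ENNReal.ofReal c * ENNReal.ofReal |b x - B / A| ≤ ‖G x‖ₑ := by
    intro x hx
    rw [← ENNReal.ofReal_mul hc.le, Real.enorm_eq_ofReal_abs]
    refine ENNReal.ofReal_le_ofReal ?_
    have : G x = A * haarF n₀ k₀ x ^ sigmaV α * (b x - B / A) := by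
      rw [hG]
      field_simp
    rw [this, abs_mul, abs_mul, abs_pow, abs_haarF (hsub hx)]
    gcongr
  have hHolder : ∫⁻ x in dyadicI n k, ‖G x‖ₑ ≤
      eLpNorm' G r volume * ENNReal.ofReal ((2 ^ (-k)) ^ (1 - 1 / r)) := by
    have := eLpNorm'_le_eLpNorm'_mul_rpow_measure_univ one_pos hr1.le
      (hGm.restrict (s := dyadicI n k))
    rw [Measure.restrict_apply_univ, volume_dyadicI, ENNReal.ofReal_rpow_of_pos (by positivity)]
      at this
    simp only [eLpNorm', ENNReal.rpow_one, div_one] at this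
    refine this.trans ?_
    gcongr
    exact eLpNorm'_mono_measure G Measure.restrict_le_self (by linarith)
  have hr0 : 0 < 1 / r := by positivity
  have hr2 : 1 / r ≤ 1 := by
    rw [div_le_one (by linarith)]
    exact hr1.le
  have hscale : (2 * (2 : ℝ) ^ (-k)) ^ (1 / r) * (2 ^ (-k)) ^ (1 - 1 / r) ≤ 2 * 2 ^ (-k) := by
    calc (2 * (2 : ℝ) ^ (-k)) ^ (1 / r) * (2 ^ (-k)) ^ (1 - 1 / r)
        ≤ (2 * (2 : ℝ) ^ (-k)) ^ (1 / r) * (2 * 2 ^ (-k)) ^ (1 - 1 / r) := by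
          gcongr
          have : (0 : ℝ) < 2 ^ (-k) := by positivity
          linarith
      _ = _ := by
          rw [← Real.rpow_add (by positivity), add_sub_cancel, Real.rpow_one]
  have hosc : ENNReal.ofReal c * ∫⁻ x in dyadicI n k, ENNReal.ofReal |b x - B / A| ≤
      ENNReal.ofReal C * ENNReal.ofReal (2 * 2 ^ (-k)) := by
    rw [← lintegral_const_mul' _ _ ENNReal.ofReal_ne_top]
    refine (setLIntegral_mono' (measurableSet_dyadicI n k) hpt).trans (hHolder.trans ?_)
    grw [hbound, hprod, mul_assoc, ← ENNReal.ofReal_mul (by positivity), hscale]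
  have hosc' : ∫⁻ x in dyadicI n k, ENNReal.ofReal |b x - B / A| ≤
      ENNReal.ofReal c⁻¹ * (ENNReal.ofReal C * ENNReal.ofReal (2 * 2 ^ (-k))) := by
    rw [ENNReal.ofReal_inv_of_pos hc, mul_comm, ← div_eq_mul_inv, ENNReal.le_div_iff_mul_le
      (by simp [hc]) (by simp), mul_comm]
    exact hosc
  grw [lintegral_abs_sub_avgI_le hb n k (B / A), hosc']
  rw [show (2 : ℝ≥0∞) = ENNReal.ofReal 2 by simp, mul_comm (ENNReal.ofReal C),
    ← mul_assoc, ← mul_assoc, ← mul_assoc, ← ENNReal.ofReal_mul (by positivity),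
    ← ENNReal.ofReal_mul (by positivity), ← ENNReal.ofReal_mul (by positivity),
    ← ENNReal.ofReal_mul (by positivity)]
  refine ENNReal.ofReal_le_ofReal (le_of_eq ?_)
  rw [zpow_neg]
  field_simp
  ring

lemma pairH_const_mul (c : ℝ) (f : ℝ → ℝ) (n k : ℤ) :
    pairH (fun x => c * f x) n k = c * pairH f n k := by
  simp_rw [pairH, mul_assoc]
  rw [integral_const_mul]

/-- The test functions at `(n, k)`: the indicator of the interval for averages and the
`L^∞`-normalized Haar function for Haar coefficients. -/
def haarTest (a : Bool) (n k : ℤ) : ℝ → ℝ :=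
  if a then (dyadicI n k).indicator 1 else fun x => Real.sqrt (2 ^ (-k)) * haarF n k x

lemma measurable_haarTest (a : Bool) (n k : ℤ) : Measurable (haarTest a n k) := by
  cases a
  · exact (measurable_haarF n k).const_mul _
  · exact measurable_one.indicator (measurableSet_dyadicI n k)

lemma abs_haarTest_le (a : Bool) (n k : ℤ) (x : ℝ) :
    |haarTest a n k x| ≤ (dyadicI n k ∪ dyadicI n k).indicator 1 x := by
  rw [Set.union_self]
  have hs : 0 < Real.sqrt ((2 : ℝ) ^ (-k)) := by positivity
  by_cases hx : x ∈ dyadicI n k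
  · cases a
    · rw [Set.indicator_of_mem hx, haarTest, if_neg (by simp), abs_mul, abs_haarF hx,
        abs_of_pos hs, mul_inv_cancel₀ hs.ne', Pi.one_apply]
    · simp [haarTest, hx]
  · cases a <;> simp [haarTest, hx, haarF_eq_zero]

lemma coefI_haarTest_self (a : Bool) (n k : ℤ) :
    coefI (haarTest a n k) a n k = if a = false then Real.sqrt (2 ^ (-k)) else 1 := by
  cases a
  · simp [coefI, haarTest, pairH_const_mul, pairH_haarF_self]
  · exact avgI_indicator_self n k

lemma coefI_haarTest_false_of_ne {n k a q : ℤ} (h : (a, q) ≠ (n, k)) :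
    coefI (haarTest false n k) false a q = 0 := by
  simp [coefI, haarTest, pairH_const_mul, pairH_haarF_of_ne h]

lemma prod_coefI_haarTest_self {m : ℕ} (α : Fin m → Bool) (n k : ℤ) :
    ∏ j, coefI (haarTest (α j) n k) (α j) n k = Real.sqrt (2 ^ (-k)) ^ sigmaV α := by
  simp_rw [coefI_haarTest_self]
  rw [← Finset.prod_filter, Finset.prod_const, sigmaV]

/-- Every dyadic interval has a sibling, and a neighbour sharing with it the grandparent but not
the parent. -/
lemma exists_sibling_and_cousin (n : ℤ) :
    ∃ s t : ℤ, s ≠ n ∧ s / 2 = n / 2 ∧ t / 2 ≠ n / 2 ∧ t / 2 / 2 = n / 2 / 2 := by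
  rcases Int.emod_two_eq_zero_or_one n with h | h <;>
    rcases Int.emod_two_eq_zero_or_one (n / 2) with h' | h'
  · exact ⟨n + 1, n + 2, by omega, by omega, by omega, by omega⟩
  · exact ⟨n + 1, n - 2, by omega, by omega, by omega, by omega⟩
  · exact ⟨n - 1, n + 2, by omega, by omega, by omega, by omega⟩
  · exact ⟨n - 1, n - 2, by omega, by omega, by omega, by omega⟩

lemma dyadicI_subset_parent (n k : ℤ) : dyadicI n (k + 1) ⊆ dyadicI (n / 2) k := by
  simpa using dyadicI_subset_coarse n k 1

lemma disjoint_dyadicI {n n' k : ℤ} (h : n ≠ n') : Disjoint (dyadicI n k) (dyadicI n' k) :=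
  Set.disjoint_left.2 fun _ hx hx' => h (eq_of_mem_dyadicI hx hx')

/-- The difference of the indicators of `(n, k + 1)` and of `(t, k + 1)`. -/
def indicatorDiff (n t k : ℤ) : ℝ → ℝ := fun x =>
  (dyadicI n (k + 1)).indicator (fun _ => (1 : ℝ)) x -
    (dyadicI t (k + 1)).indicator (fun _ => (1 : ℝ)) x

lemma avgI_indicatorDiff (n t k a q : ℤ) :
    avgI (indicatorDiff n t k) a q = 2 ^ q *
      ((∫ x in dyadicI a q, (dyadicI n (k + 1)).indicator (fun _ => (1 : ℝ)) x) -
        ∫ x in dyadicI a q, (dyadicI t (k + 1)).indicator (fun _ => (1 : ℝ)) x) := by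
  rw [avgI, ← integral_sub (integrable_indicator_dyadicI _ _).integrableOn
    (integrable_indicator_dyadicI _ _).integrableOn]
  rfl

lemma measurable_indicatorDiff (n t k : ℤ) : Measurable (indicatorDiff n t k) :=
  (measurable_const.indicator (measurableSet_dyadicI _ _)).sub
    (measurable_const.indicator (measurableSet_dyadicI _ _))

lemma abs_indicatorDiff_le (n t k : ℤ) (x : ℝ) :
    |indicatorDiff n t k x| ≤ (dyadicI n (k + 1) ∪ dyadicI t (k + 1)).indicator 1 x := by
  by_cases hn : x ∈ dyadicI n (k + 1) <;> by_cases ht : x ∈ dyadicI t (k + 1) <;>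
    simp [indicatorDiff, hn, ht]

lemma avgI_indicatorDiff_parent {n t : ℤ} (k : ℤ) (ht : t / 2 ≠ n / 2) :
    avgI (indicatorDiff n t k) (n / 2) k = 1 / 2 := by
  rw [avgI_indicatorDiff, setIntegral_indicator_of_subset (dyadicI_subset_parent n k),
    setIntegral_indicator_of_disjoint
      ((disjoint_dyadicI ht).mono_left (dyadicI_subset_parent t k)), sub_zero,
    ← zpow_add₀ two_ne_zero]
  norm_num

lemma avgI_indicatorDiff_coarse {n t a k q : ℤ} (ht : t / 2 / 2 = n / 2 / 2) (hq : q < k) :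
    avgI (indicatorDiff n t k) a q = 0 := by
  have hsub (s : ℤ) : dyadicI s (k + 1) ⊆ dyadicI (s / 2 / 2) (k - 1) := by
    refine (dyadicI_subset_parent s k).trans ?_
    simpa using dyadicI_subset_parent (s / 2) (k - 1)
  by_cases h : ∃ y ∈ dyadicI (n / 2 / 2) (k - 1), y ∈ dyadicI a q
  · obtain ⟨y, hy, hya⟩ := h
    have hle : dyadicI (n / 2 / 2) (k - 1) ⊆ dyadicI a q := fun x hx =>
      (mem_dyadicI_congr (by omega) hx hy).2 hya
    rw [avgI_indicatorDiff, setIntegral_indicator_of_subset ((hsub n).trans hle),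
      setIntegral_indicator_of_subset ((hsub t).trans (ht ▸ hle)), sub_self, mul_zero]
  · refine avgI_eq_zero_of_disjoint fun x hx => ?_
    have hn : x ∉ dyadicI n (k + 1) := fun h' => h ⟨x, hsub n h', hx⟩
    have ht' : x ∉ dyadicI t (k + 1) := fun h' => h ⟨x, ht ▸ hsub t h', hx⟩
    simp [indicatorDiff, hn, ht']

lemma pairH_eq_zero_or_avgI_indicatorDiff_eq_zero {n s t k : ℤ} (hsn : s ≠ n) (hs : s / 2 = n / 2)
    (ht : t / 2 ≠ n / 2) (ht' : t / 2 / 2 = n / 2 / 2) {g : ℝ → ℝ}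
    (hg : ∀ x ∉ dyadicI s (k + 1), g x = 0) {a q : ℤ} (h : (a, q) ≠ (n / 2, k)) :
    pairH g a q = 0 ∨ avgI (indicatorDiff n t k) a q = 0 := by
  rcases lt_trichotomy q k with hq | rfl | hq
  · exact Or.inr (avgI_indicatorDiff_coarse ht' hq)
  · refine Or.inl (pairH_eq_zero_of_disjoint fun x hx => hg x fun hx' => h ?_)
    rw [eq_of_mem_dyadicI hx (dyadicI_subset_parent s q hx'), hs]
  · by_cases hy : ∃ y ∈ dyadicI a q, y ∈ dyadicI s (k + 1)
    · obtain ⟨y, hya, hys⟩ := hy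
      refine Or.inr (avgI_eq_zero_of_disjoint fun x hx => ?_)
      have hxs := (mem_dyadicI_congr (by omega) hya hx).1 hys
      have hn : x ∉ dyadicI n (k + 1) := fun h' => hsn (eq_of_mem_dyadicI hxs h')
      have ht'' : x ∉ dyadicI t (k + 1) := fun h' => ht (eq_of_mem_dyadicI hxs h' ▸ hs)
      simp [indicatorDiff, hn, ht'']
    · exact Or.inl (pairH_eq_zero_of_disjoint fun x hx => hg x fun hx' => hy ⟨x, hx, hx'⟩)

lemma abs_pairH_indicator_parent (s k : ℤ) :
    |pairH ((dyadicI s (k + 1)).indicator 1) (s / 2) k| =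
      (Real.sqrt (2 ^ (-k)))⁻¹ * 2 ^ (-(k + 1)) := by
  obtain ⟨y, hy⟩ := dyadicI_nonempty s (k + 1)
  have : ∀ x, (dyadicI s (k + 1)).indicator 1 x * haarF (s / 2) k x =
      (dyadicI s (k + 1)).indicator (fun _ => haarF (s / 2) k y) x := by
    intro x
    by_cases hx : x ∈ dyadicI s (k + 1)
    · simp [hx, haarF_congr (by omega : k < k + 1) hx hy]
    · simp [hx]
  simp_rw [pairH, this]
  rw [integral_indicator_const _ (measurableSet_dyadicI _ _), volume_real_dyadicI, smul_eq_mul,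
    abs_mul, abs_haarF (dyadicI_subset_parent s k hy), abs_of_pos (by positivity), mul_comm]

/-- For `m ≥ 2`, `α⃗ ∈ U_m`, `1 ≤ i ≤ m`, `1 < p_j, r < ∞` with
`Σ_j 1/p_j = 1/r` and `b` locally integrable: if the commutator
`[b, P^{α⃗}]_i(f⃗) = b·P^{α⃗}(f⃗) − P^{α⃗}(f₁,…,b f_i,…,f_m)` satisfies
`‖[b, P^{α⃗}]_i(f₁,…,f_m)‖_{L^r} ≤ C ∏_j ‖f_j‖_{L^{p_j}}` for all bounded compactly
supported `f_j`, then `b ∈ BMO^d` with `‖b‖_{BMO^d} ≤ C'·C`, `C' = C'(m, α⃗, p⃗, r)`. -/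
theorem statement17 (m : ℕ) (hm : 2 ≤ m) (α : Fin m → Bool) (hα : α ≠ fun _ => true)
    (i : Fin m) (p : Fin m → ℝ) (hp : ∀ j, 1 < p j) (r : ℝ) (hr1 : 1 < r)
    (hr : ∑ j, 1 / p j = 1 / r) :
    ∃ C' : ℝ, 0 < C' ∧ ∀ b : ℝ → ℝ, LocallyIntegrable b volume → ∀ C : ℝ,
      (∀ (f : Fin m → ℝ → ℝ) (g₁ g₂ : ℝ → ℝ), (∀ j, BCS (f j)) →
        HasDyadicSum (Pterm α f) g₁ →
        HasDyadicSum (Pterm α (Function.update f i fun x => b x * f i x)) g₂ →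
        eLpNorm' (fun x => b x * g₁ x - g₂ x) r volume ≤
          ENNReal.ofReal C * ∏ j, eLpNorm (f j) (ENNReal.ofReal (p j)) volume) →
      bmoNorm b < ⊤ ∧ bmoNorm b ≤ ENNReal.ofReal (C' * C) := by
  refine ⟨4 * (2⁻¹ ^ m)⁻¹, by positivity, fun b hb C hC => ?_⟩
  suffices h : bmoNorm b ≤ ENNReal.ofReal (4 * (2⁻¹ ^ m)⁻¹ * C) from
    ⟨h.trans_lt ENNReal.ofReal_lt_top, h⟩
  refine iSup_le fun n => iSup_le fun k' => ?_
  obtain ⟨k, rfl⟩ : ∃ k, k' = k + 1 := ⟨k' - 1, by ring⟩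
  by_cases hl : ∃ l, l ≠ i ∧ α l = false
  · obtain ⟨l, hli, hαl⟩ := hl
    refine oscillation_le_of_commutator_bound hp hr1 hr hb hC subset_rfl
      (f := fun j => haarTest (α j) n (k + 1)) (fun j => measurable_haarTest _ _ _)
      (fun j => ⟨n, n, abs_haarTest_le _ _ _⟩) (fun a q h => ?_) (fun a q h => ?_)
      (by positivity) ?_
    · exact Finset.prod_eq_zero (Finset.mem_univ l) (by rw [hαl, coefI_haarTest_false_of_ne h])
    · refine Finset.prod_eq_zero (Finset.mem_univ l) ?_
      rw [Function.update_of_ne hli, hαl, coefI_haarTest_false_of_ne h]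
    · rw [prod_coefI_haarTest_self, abs_of_nonneg (by positivity), ← mul_pow,
        mul_inv_cancel₀ (by positivity), one_pow]
      exact pow_le_one₀ (by norm_num) (by norm_num)
  · push Not at hl
    simp only [ne_eq, Bool.not_eq_false] at hl
    have hαi : α i = false := by
      by_contra h
      refine hα (funext fun j => ?_)
      by_cases hj : j = i
      · simpa [hj] using h
      · exact hl j hj
    obtain ⟨s, t, hsn, hs, ht, ht'⟩ := exists_sibling_and_cousin n
    obtain ⟨l, hli⟩ : ∃ l, l ≠ i := by
      have : Nontrivial (Fin m) := Fin.nontrivial_iff_two_le.2 hm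
      exact exists_ne i
    have hvanish (g : ℝ → ℝ) (hg : ∀ x ∉ dyadicI s (k + 1), g x = 0) (F : Fin m → ℝ → ℝ)
        (hFi : F i = g) (hFl : F l = indicatorDiff n t k) (a q : ℤ) (h : (a, q) ≠ (n / 2, k)) :
        ∏ j, coefI (F j) (α j) a q = 0 := by
      rcases pairH_eq_zero_or_avgI_indicatorDiff_eq_zero hsn hs ht ht' hg h with h0 | h0
      · exact Finset.prod_eq_zero (Finset.mem_univ i) (by simp [coefI, hαi, hFi, h0])
      · exact Finset.prod_eq_zero (Finset.mem_univ l) (by simp [coefI, hl l hli, hFl, h0])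
    refine oscillation_le_of_commutator_bound hp hr1 hr hb hC (dyadicI_subset_parent n k)
      (f := fun j => if j = i then (dyadicI s (k + 1)).indicator 1 else indicatorDiff n t k)
      (fun j => ?_) (fun j => ?_) (hvanish ((dyadicI s (k + 1)).indicator 1) ?_ _ ?_ ?_)
      (hvanish (fun x => b x * (dyadicI s (k + 1)).indicator 1 x) ?_ _ ?_ ?_) (by positivity) ?_
    · split_ifs
      · exact measurable_one.indicator (measurableSet_dyadicI _ _)
      · exact measurable_indicatorDiff n t k
    · by_cases hj : j = i
      · refine ⟨s, s, fun x => ?_⟩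
        rw [if_pos hj, Set.union_self, abs_of_nonneg (Set.indicator_nonneg (by simp) x)]
      · simp only [if_neg hj]
        exact ⟨n, t, abs_indicatorDiff_le n t k⟩
    · exact fun x hx => Set.indicator_of_notMem hx _
    · simp
    · simp [hli]
    · intro x hx
      simp [hx]
    · simp
    · simp [hli]
    · have hσ : sigmaV α = 1 := by
        rw [sigmaV, Finset.card_eq_one]
        refine ⟨i, Finset.ext fun j => ?_⟩
        by_cases hj : j = i
        · simp [hj, hαi]
        · simp [hj, hl j hj]
      have hrest : ∏ j ∈ Finset.univ.erase i, coefI (if j = i then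
          (dyadicI s (k + 1)).indicator 1 else indicatorDiff n t k) (α j) (n / 2) k =
          2⁻¹ ^ (m - 1) := by
        rw [Finset.prod_eq_pow_card (b := (2⁻¹ : ℝ)), Finset.card_erase_of_mem (Finset.mem_univ i),
          Finset.card_univ, Fintype.card_fin]
        intro j hj
        have hj := Finset.ne_of_mem_erase hj
        simp [coefI, hj, hl j hj, avgI_indicatorDiff_parent k ht]
      rw [← Finset.mul_prod_erase _ _ (Finset.mem_univ i), hrest, if_pos rfl, hαi, hσ, pow_one,
        abs_mul, coefI, if_neg (by simp), ← hs, abs_pairH_indicator_parent,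
        abs_of_pos (by positivity : (0 : ℝ) < 2⁻¹ ^ (m - 1))]
      have hsq : (Real.sqrt ((2 : ℝ) ^ (-k)))⁻¹ * (Real.sqrt (2 ^ (-k)))⁻¹ = 2 ^ k := by
        rw [← mul_inv, Real.mul_self_sqrt (by positivity), zpow_neg, inv_inv]
      have hhalf : (2 : ℝ) ^ k * 2 ^ (-(k + 1)) = 2⁻¹ := by
        rw [← zpow_add₀ two_ne_zero]
        norm_num
      obtain ⟨m', rfl⟩ : ∃ m', m = m' + 1 := ⟨m - 1, by omega⟩
      refine le_of_eq ?_
      calc (2⁻¹ : ℝ) ^ (m' + 1) = 2⁻¹ ^ m' * 2⁻¹ := pow_succ _ _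
        _ = _ := by
          rw [Nat.add_sub_cancel]
          linear_combination (-(2⁻¹ : ℝ) ^ m') * hhalf - 2⁻¹ ^ m' * 2 ^ (-(k + 1)) * hsq

end
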